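/- arXiv:2105.04988 — 6 statements merged into one kernel-verified Lean document; each statement's English description precedes it below -/
import Mathlib

section
/- Suppose (x*, λ*) satisfies the KKT conditions ∇Ψ(x*) + λ*∇c(x*) = 0 and c(x*) = 0 with λ* > 0, that ∇c(x*) ≠ 0, and that the matrix ∇²Ψ(x*) + λ* J(x*)ᵀJ(x*) is positive definite. Then there exists ρ > 0 such that for every x in the open ball of radius ρ centered at x*, there exist p ∈ ℝⁿ and λ > 0 solving the sub-problem KKT system: ∇Ψ(x + p) + λ(∇c(x) + J(x)ᵀJ(x)p) = 0 and c(x) + ⟨∇c(x), p⟩ + ½⟨p, J(x)ᵀJ(x)p⟩ = 0. -/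
open RealInnerProductSpace

variable {n m : ℕ}

local notation "En" => EuclideanSpace ℝ (Fin n)
local notation "Em" => EuclideanSpace ℝ (Fin m)

/-- A map into Euclidean space is `C^k` if all its inner products with fixed vectors are. -/
theorem contDiff_of_forall_inner {E : Type*} [NormedAddCommGroup E] [NormedSpace ℝ E]
    {k : WithTop ℕ∞} {f : E → En} (h : ∀ v : En, ContDiff ℝ k fun x => ⟪v, f x⟫) :
    ContDiff ℝ k f := by
  rw [contDiff_euclidean]
  intro i
  simpa [EuclideanSpace.inner_single_left] using h (EuclideanSpace.single i 1)

theorem contDiff_adjoint_apply {E : Type*} [NormedAddCommGroup E] [NormedSpace ℝ E]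
    {k : WithTop ℕ∞} {A : E → (En →L[ℝ] Em)} {w : E → Em} (hA : ContDiff ℝ k A)
    (hw : ContDiff ℝ k w) : ContDiff ℝ k fun x => ContinuousLinearMap.adjoint (A x) (w x) := by
  refine contDiff_of_forall_inner fun v => ?_
  simp only [ContinuousLinearMap.adjoint_inner_right]
  exact (hA.clm_apply contDiff_const).inner ℝ hw

theorem contDiff_gradient {f : En → ℝ} {k l : WithTop ℕ∞} (hf : ContDiff ℝ l f)
    (hkl : k + 1 ≤ l) : ContDiff ℝ k (gradient f) := by
  refine contDiff_of_forall_inner fun v => ?_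
  have : (fun x => ⟪v, gradient f x⟫) = fun x => fderiv ℝ f x v := by
    ext x
    rw [real_inner_comm, gradient, InnerProductSpace.toDual_symm_apply]
  rw [this]
  exact (hf.fderiv_right hkl).clm_apply contDiff_const

/-- If `f` is `C¹` and the derivative of `f (a, ·)` at `b` is injective, between spaces of equal
finite dimension, then `f (x, ·) = f (a, b)` has a solution near `b` for every `x` near `a`. -/
theorem eventually_exists_solution_of_injective_partial
    {E F G : Type*} [NormedAddCommGroup E] [NormedSpace ℝ E] [CompleteSpace E]
    [NormedAddCommGroup F] [NormedSpace ℝ F] [FiniteDimensional ℝ F]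
    [NormedAddCommGroup G] [NormedSpace ℝ G] [FiniteDimensional ℝ G]
    (hdim : Module.finrank ℝ F = Module.finrank ℝ G)
    {f : E × F → G} (hf : ContDiff ℝ 1 f) {a : E} {b : F} {L : F →L[ℝ] G}
    (hL : HasFDerivAt (fun y => f (a, y)) L b) (hinj : Function.Injective L)
    {U : Set F} (hU : U ∈ nhds b) :
    ∀ᶠ x in nhds a, ∃ y ∈ U, f (x, y) = f (a, b) := by
  have : CompleteSpace F := FiniteDimensional.complete ℝ F
  have : CompleteSpace G := FiniteDimensional.complete ℝ G
  have hstrict : HasStrictFDerivAt f (fderiv ℝ f (a, b)) (a, b) :=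
    hf.contDiffAt.hasStrictFDerivAt one_ne_zero
  have hpartial : fderiv ℝ f (a, b) ∘L .inr ℝ E F = L :=
    (hstrict.hasFDerivAt.comp b (hasFDerivAt_prodMk_right a b)).unique hL
  have hinv : (fderiv ℝ f (a, b) ∘L .inr ℝ E F).IsInvertible := by
    rw [hpartial]
    exact ⟨(LinearEquiv.ofInjectiveOfFinrankEq L.toLinearMap hinj hdim).toContinuousLinearEquiv,
      by ext; rfl⟩
  filter_upwards [hstrict.eventually_apply_implicitFunctionOfProdDomain hinv,
    (hstrict.tendsto_implicitFunctionOfProdDomain hinv).eventually hU] with x hx hxU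
  exact ⟨_, hxU, hx⟩

/-- If (x*, λ*) is a KKT point with λ* > 0, ∇c(x*) ≠ 0 and
∇²Ψ(x*) + λ* J(x*)ᵀJ(x*) positive definite, then there is ρ > 0 such that for every
x in the open ball of radius ρ around x* the sub-problem KKT system has a solution
(p, λ) with λ > 0. -/
theorem stmt_5
    (s : En → Em) (J : En → (En →L[ℝ] Em)) (b : Em) (σ : ℝ) (hσ : 0 < σ)
    (hs : ContDiff ℝ 2 s) (hJ : ∀ x, HasFDerivAt s (J x) x)
    (Ψ : En → ℝ) (hΨ : ContDiff ℝ 2 Ψ) (hconv : ConvexOn ℝ Set.univ Ψ)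
    (c : En → ℝ) (hc : ∀ x, c x = ‖s x - b‖ ^ 2 / 2 - σ ^ 2 / 2)
    (gradc : En → En)
    (hgradc : ∀ x, gradc x = (ContinuousLinearMap.adjoint (J x)) (s x - b))
    (HΨ : En → (En →L[ℝ] En)) (hHΨ : ∀ x, HΨ x = fderiv ℝ (gradient Ψ) x)
    (xstar : En) (lamstar : ℝ) (hlam : 0 < lamstar)
    (hkkt1 : gradient Ψ xstar + lamstar • gradc xstar = 0)
    (hkkt2 : c xstar = 0)
    (hnz : gradc xstar ≠ 0)
    (hpd : ∀ v : En, v ≠ 0 →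
      0 < ⟪v, HΨ xstar v⟫ +
        lamstar * ⟪v, (ContinuousLinearMap.adjoint (J xstar)) (J xstar v)⟫) :
    ∃ ρ > (0:ℝ), ∀ x ∈ Metric.ball xstar ρ, ∃ (p : En) (lam : ℝ), 0 < lam ∧
      gradient Ψ (x + p) +
        lam • (gradc x + (ContinuousLinearMap.adjoint (J x)) (J x p)) = 0 ∧
      c x + ⟪gradc x, p⟫ +
        (1 / 2) * ⟪p, (ContinuousLinearMap.adjoint (J x)) (J x p)⟫ = 0 := by
  have hsm : ContDiff ℝ 1 s := hs.of_le (by norm_num)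
  have hJsm : ContDiff ℝ 1 J := by
    have : J = fderiv ℝ s := funext fun x => (hJ x).fderiv.symm
    rw [this]
    exact hs.fderiv_right (by norm_num)
  have hgc : ContDiff ℝ 1 gradc := by
    rw [funext hgradc]
    exact contDiff_adjoint_apply hJsm (hsm.sub contDiff_const)
  have hcsm : ContDiff ℝ 1 c := by
    rw [funext hc]
    exact (((hsm.sub contDiff_const).norm_sq ℝ).div_const 2).sub contDiff_const
  have hgΨ : ContDiff ℝ 1 (gradient Ψ) := contDiff_gradient hΨ (by norm_num)
  let f : En × (En × ℝ) → En × ℝ := fun z =>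
    (gradient Ψ (z.1 + z.2.1) + z.2.2 • (gradc z.1 +
        (ContinuousLinearMap.adjoint (J z.1)) (J z.1 z.2.1)),
      c z.1 + ⟪gradc z.1, z.2.1⟫ +
        (1 / 2) * ⟪z.2.1, (ContinuousLinearMap.adjoint (J z.1)) (J z.1 z.2.1)⟫)
  have hp : ContDiff ℝ 1 fun z : En × (En × ℝ) => z.2.1 := by fun_prop
  have hgcz : ContDiff ℝ 1 fun z : En × (En × ℝ) => gradc z.1 := hgc.comp contDiff_fst
  have hJz : ContDiff ℝ 1 fun z : En × (En × ℝ) => J z.1 := hJsm.comp contDiff_fst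
  have hB : ContDiff ℝ 1 fun z : En × (En × ℝ) =>
      (ContinuousLinearMap.adjoint (J z.1)) (J z.1 z.2.1) :=
    contDiff_adjoint_apply hJz (hJz.clm_apply hp)
  have hf : ContDiff ℝ 1 f := by
    refine ContDiff.prodMk ?_ ?_
    · exact (hgΨ.comp (contDiff_fst.add hp)).add
        ((contDiff_snd.comp contDiff_snd).smul (hgcz.add hB))
    · exact ((hcsm.comp contDiff_fst).add (hgcz.inner ℝ hp)).add
        (contDiff_const.mul (hp.inner ℝ hB))
  let A : En →L[ℝ] En := ContinuousLinearMap.adjoint (J xstar) ∘L J xstar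
  let P : En × ℝ →L[ℝ] En := .fst ℝ En ℝ
  let R : En × ℝ →L[ℝ] ℝ := .snd ℝ En ℝ
  let L : En × ℝ →L[ℝ] En × ℝ :=
    (HΨ xstar ∘L P + lamstar • (A ∘L P) + R.smulRight (gradc xstar)).prod
      (innerSL ℝ (gradc xstar) ∘L P)
  have hL : HasFDerivAt (fun y => f (xstar, y)) L (0, lamstar) := by
    have hP : HasFDerivAt (fun y : En × ℝ => y.1) P (0, lamstar) := P.hasFDerivAt
    have hR : HasFDerivAt (fun y : En × ℝ => y.2) R (0, lamstar) := R.hasFDerivAt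
    have hA : HasFDerivAt (fun y : En × ℝ => A y.1) (A ∘L P) (0, lamstar) :=
      A.hasFDerivAt.comp _ hP
    have hH : HasFDerivAt (fun y : En × ℝ => gradient Ψ (xstar + y.1))
        (HΨ xstar ∘L P) (0, lamstar) := by
      have h : HasFDerivAt (gradient Ψ) (HΨ xstar) (xstar + ((0 : En), lamstar).1) := by
        rw [hHΨ]
        simpa using (hgΨ.differentiable one_ne_zero xstar).hasFDerivAt
      exact h.comp (0, lamstar) (hP.const_add xstar)
    have h1 := hH.add (hR.smul (hA.const_add (gradc xstar)))
    have h2 := (((innerSL ℝ (gradc xstar)).hasFDerivAt.comp _ hP).const_add (c xstar)).add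
      ((hP.inner ℝ hA).const_mul (1 / 2))
    refine (h1.prodMk h2).congr_fderiv ?_
    ext y <;> simp [L, P, R, A]
  have hinj : Function.Injective L := by
    rw [injective_iff_map_eq_zero]
    rintro ⟨q, μ⟩ h
    obtain ⟨h1, h2⟩ := Prod.ext_iff.mp h
    replace h1 : HΨ xstar q + lamstar • A q + μ • gradc xstar = 0 := h1
    replace h2 : ⟪gradc xstar, q⟫ = 0 := h2
    have hq : q = 0 := by
      by_contra hq
      have h3 := congrArg (fun w => ⟪q, w⟫) h1
      simp only [inner_add_right, inner_smul_right, inner_zero_right,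
        (real_inner_comm _ _).trans h2] at h3
      have h4 := hpd q hq
      simp only [A, ContinuousLinearMap.comp_apply] at h3
      linarith
    subst hq
    have hμ : μ = 0 := by simpa [hnz] using h1
    simp [hμ]
  have hU : {y : En × ℝ | 0 < y.2} ∈ nhds ((0 : En), lamstar) :=
    (isOpen_lt continuous_const continuous_snd).mem_nhds hlam
  have h0 : f (xstar, (0, lamstar)) = 0 := by simp [f, hkkt1, hkkt2]
  obtain ⟨ρ, hρ, hsol⟩ := Metric.eventually_nhds_iff_ball.mp
    (eventually_exists_solution_of_injective_partial rfl hf hL hinj hU)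
  refine ⟨ρ, hρ, fun x hx => ?_⟩
  obtain ⟨⟨p, lam⟩, hpos, hsolx⟩ := hsol x hx
  obtain ⟨h1, h2⟩ := Prod.ext_iff.mp (hsolx.trans h0)
  exact ⟨p, lam, hpos, h1, h2⟩
end

section
/- Let x ∈ ℝⁿ and suppose (p, λ) satisfies the sub-problem KKT system at x: ∇Ψ(x + p) + λ(∇c(x) + J(x)ᵀJ(x)p) = 0 and c(x) + ⟨∇c(x), p⟩ + ½⟨p, J(x)ᵀJ(x)p⟩ = 0. Set φ = sup_{t ∈ [0,1]} ½‖∇²Ψ(x + t p)‖ (operator norm of the Hessian along the segment from x to x + p). Then for every β ∈ [0,1]: Ψ(x + β p) − Ψ(x) ≤ −(βλ/2)⟨p, J(x)ᵀJ(x)p⟩ + λ β c(x) + φ β² ‖p‖². -/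
open RealInnerProductSpace

variable {n m : ℕ}

local notation "En" => EuclideanSpace ℝ (Fin n)
local notation "Em" => EuclideanSpace ℝ (Fin m)

/-- The gradient inequality for a convex function, tested at the end of a segment. -/
theorem ConvexOn.sub_le_inner_gradient {E : Type*} [NormedAddCommGroup E]
    [InnerProductSpace ℝ E] [CompleteSpace E] {f : E → ℝ} (hf : ConvexOn ℝ Set.univ f)
    {x p : E} (hd : DifferentiableAt ℝ f (x + p)) :
    f (x + p) - f x ≤ inner ℝ (gradient f (x + p)) p := by
  have hline : ConvexOn ℝ Set.univ (fun t : ℝ => f (x + t • p)) := by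
    have := hf.comp_affineMap (AffineMap.lineMap x (x + p) : ℝ →ᵃ[ℝ] E)
    simpa [Function.comp_def, AffineMap.lineMap_apply, add_comm] using this
  have hderiv : HasDerivAt (fun t : ℝ => f (x + t • p)) (inner ℝ (gradient f (x + p)) p) 1 := by
    have hp : HasDerivAt (fun t : ℝ => x + t • p) p 1 := by
      simpa using ((hasDerivAt_id (1 : ℝ)).smul_const p).const_add x
    have hg : HasFDerivAt f (fderiv ℝ f (x + p)) (x + (1 : ℝ) • p) := by
      simpa using hd.hasFDerivAt
    simpa [gradient, Function.comp_def] using hg.comp_hasDerivAt (1 : ℝ) hp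
  have := hline.slope_le_of_hasDerivAt (Set.mem_univ 0) (Set.mem_univ 1) one_pos hderiv
  simpa [slope_def_field] using this

/-- If (p, λ) solves the sub-problem KKT system at x and
φ = sup_{t∈[0,1]} ½‖∇²Ψ(x+tp)‖, then for every β ∈ [0,1]:
Ψ(x+βp) − Ψ(x) ≤ −(βλ/2)⟨p, J(x)ᵀJ(x)p⟩ + λβc(x) + φβ²‖p‖². -/
theorem stmt_6
    (s : En → Em) (J : En → (En →L[ℝ] Em)) (b : Em) (σ : ℝ) (hσ : 0 < σ)
    (hs : ContDiff ℝ 1 s) (hJ : ∀ x, HasFDerivAt s (J x) x)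
    (Ψ : En → ℝ) (hΨ : ContDiff ℝ 2 Ψ) (hconv : ConvexOn ℝ Set.univ Ψ)
    (c : En → ℝ) (hc : ∀ x, c x = ‖s x - b‖ ^ 2 / 2 - σ ^ 2 / 2)
    (gradc : En → En)
    (hgradc : ∀ x, gradc x = (ContinuousLinearMap.adjoint (J x)) (s x - b))
    (x p : En) (lam : ℝ)
    (hkkt1 : gradient Ψ (x + p) +
      lam • (gradc x + (ContinuousLinearMap.adjoint (J x)) (J x p)) = 0)
    (hkkt2 : c x + ⟪gradc x, p⟫ +
      (1 / 2) * ⟪p, (ContinuousLinearMap.adjoint (J x)) (J x p)⟫ = 0)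
    (φ : ℝ)
    (hφ : φ = ⨆ t : Set.Icc (0:ℝ) 1,
      (1 / 2) * ‖fderiv ℝ (gradient Ψ) (x + (t : ℝ) • p)‖) :
    ∀ β ∈ Set.Icc (0:ℝ) 1,
      Ψ (x + β • p) - Ψ x ≤
        -(β * lam / 2) * ⟪p, (ContinuousLinearMap.adjoint (J x)) (J x p)⟫ +
          lam * β * c x + φ * β ^ 2 * ‖p‖ ^ 2 := by
  rintro β ⟨hβ0, hβ1⟩
  set q := ⟪p, (ContinuousLinearMap.adjoint (J x)) (J x p)⟫ with hq
  have hφ0 : 0 ≤ φ := hφ ▸ Real.iSup_nonneg fun _ => by positivity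
  have hgrad : ⟪gradient Ψ (x + p), p⟫ = lam * (c x - q / 2) := by
    have h := congrArg (fun v => ⟪v, p⟫) hkkt1
    simp only [inner_add_left, real_inner_smul_left, inner_zero_left] at h
    rw [real_inner_comm p ((ContinuousLinearMap.adjoint (J x)) (J x p)), ← hq] at h
    linear_combination h - lam * hkkt2
  have hend : Ψ (x + p) - Ψ x ≤ lam * (c x - q / 2) :=
    hgrad ▸ hconv.sub_le_inner_gradient (hΨ.differentiable two_ne_zero _)
  have hchord : Ψ (x + β • p) ≤ (1 - β) * Ψ x + β * Ψ (x + p) := by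
    have h := hconv.2 (Set.mem_univ x) (Set.mem_univ (x + p)) (sub_nonneg.2 hβ1) hβ0 (by ring)
    rwa [show (1 - β) • x + β • (x + p) = x + β • p by module] at h
  have hrem : 0 ≤ φ * β ^ 2 * ‖p‖ ^ 2 := by positivity
  linarith [mul_le_mul_of_nonneg_left hend hβ0]
end

section
/- Let c : ℝⁿ → ℝ be twice continuously differentiable, x, p ∈ ℝⁿ, and suppose c(x) + ⟨∇c(x), p⟩ ≤ 0. Set φ₂ = sup_{t ∈ [0,1]} ½‖∇²c(x + t p)‖ (operator norm of the Hessian along the segment from x to x + p). Then for every β ∈ [0,1]: [c(x + β p)]₊ − [c(x)]₊ ≤ −β [c(x)]₊ + φ₂ β² ‖p‖². -/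
open RealInnerProductSpace

variable {n : ℕ}

local notation "En" => EuclideanSpace ℝ (Fin n)

open scoped Gradient in
theorem ContDiff.contDiff_one_gradient {E : Type*} [NormedAddCommGroup E] [InnerProductSpace ℝ E]
    [CompleteSpace E] {f : E → ℝ} (hf : ContDiff ℝ 2 f) : ContDiff ℝ 1 (∇ f) := by
  let L : (E →L[ℝ] ℝ) →L[ℝ] E :=
    { toFun := (InnerProductSpace.toDual ℝ E).symm
      map_add' := fun a b => map_add _ a b
      map_smul' := fun a b => by simp
      cont := (InnerProductSpace.toDual ℝ E).symm.continuous }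
  exact L.contDiff.comp (hf.fderiv_right (m := 1) (by norm_num))

open scoped Gradient in
/-- Second-order upper bound along a segment on which the Hessian is bounded by `2 * M`. -/
theorem le_add_inner_gradient_add_of_norm_fderiv_gradient_le {E : Type*} [NormedAddCommGroup E]
    [InnerProductSpace ℝ E] [CompleteSpace E] {f : E → ℝ} (hf : ContDiff ℝ 2 f) {x p : E} {M : ℝ}
    (hM : ∀ t ∈ Set.Icc (0 : ℝ) 1, 1 / 2 * ‖fderiv ℝ (∇ f) (x + t • p)‖ ≤ M)
    {b : ℝ} (hb : b ∈ Set.Icc (0 : ℝ) 1) :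
    f (x + b • p) ≤ f x + b * ⟪∇ f x, p⟫ + M * b ^ 2 * ‖p‖ ^ 2 := by
  have hline (t : ℝ) : HasDerivAt (fun s : ℝ => x + s • p) p t := by
    simpa using ((hasDerivAt_id t).smul_const p).const_add x
  have hgrad (t : ℝ) : HasDerivAt (fun s : ℝ => ∇ f (x + s • p))
      (fderiv ℝ (∇ f) (x + t • p) p) t :=
    ((hf.contDiff_one_gradient.differentiable one_ne_zero _).hasFDerivAt).comp_hasDerivAt t (hline t)
  have hval (t : ℝ) : HasDerivAt (fun s : ℝ => f (x + s • p)) ⟪∇ f (x + t • p), p⟫ t := by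
    have h := (((hf.differentiable two_ne_zero (x + t • p)).hasGradientAt).hasFDerivAt).comp_hasDerivAt
      t (hline t)
    simpa [Function.comp_def] using h
  have hvar : ∀ t ∈ Set.Icc (0 : ℝ) 1, ‖∇ f (x + t • p) - ∇ f x‖ ≤ 2 * M * ‖p‖ * t := by
    intro t ht
    have h := norm_image_sub_le_of_norm_deriv_le_segment' (C := 2 * M * ‖p‖)
      (fun s _ => (hgrad s).hasDerivWithinAt) (fun s hs => by
        refine (ContinuousLinearMap.le_opNorm _ _).trans ?_
        gcongr
        linarith [hM s (Set.Ico_subset_Icc_self hs)]) t ht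
    simpa using h
  let r : ℝ → ℝ := fun t => f (x + t • p) - t * ⟪∇ f x, p⟫ - M * ‖p‖ ^ 2 * t ^ 2
  have hr (t : ℝ) : HasDerivAt r
      (⟪∇ f (x + t • p), p⟫ - ⟪∇ f x, p⟫ - M * ‖p‖ ^ 2 * (2 * t)) t := by
    have h := ((hval t).sub ((hasDerivAt_id t).mul_const ⟪∇ f x, p⟫)).sub
      ((hasDerivAt_pow 2 t).const_mul (M * ‖p‖ ^ 2))
    exact h.congr_deriv (by simp)
  have hanti : AntitoneOn r (Set.Icc 0 1) := by
    refine antitoneOn_of_deriv_nonpos (convex_Icc 0 1)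
      (fun t _ => (hr t).continuousAt.continuousWithinAt)
      (fun t _ => (hr t).differentiableAt.differentiableWithinAt) fun t ht => ?_
    rw [(hr t).deriv, ← inner_sub_left]
    have h₁ := real_inner_le_norm (∇ f (x + t • p) - ∇ f x) p
    have h₂ := mul_le_mul_of_nonneg_right (hvar t (interior_subset ht)) (norm_nonneg p)
    linarith
  have h := hanti (Set.left_mem_Icc.2 zero_le_one) hb hb.1
  simp only [r, zero_smul, add_zero] at h
  linarith

/-- For twice continuously differentiable c with c(x) + ⟨∇c(x), p⟩ ≤ 0
and φ₂ = sup_{t∈[0,1]} ½‖∇²c(x+tp)‖, for every β ∈ [0,1]: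
[c(x+βp)]₊ − [c(x)]₊ ≤ −β[c(x)]₊ + φ₂β²‖p‖². -/
theorem stmt_7
    (c : En → ℝ) (hc : ContDiff ℝ 2 c)
    (x p : En)
    (hdesc : c x + ⟪gradient c x, p⟫ ≤ 0)
    (φ₂ : ℝ)
    (hφ₂ : φ₂ = ⨆ t : Set.Icc (0:ℝ) 1,
      (1 / 2) * ‖fderiv ℝ (gradient c) (x + (t : ℝ) • p)‖) :
    ∀ β ∈ Set.Icc (0:ℝ) 1,
      max 0 (c (x + β • p)) - max 0 (c x) ≤
        -β * max 0 (c x) + φ₂ * β ^ 2 * ‖p‖ ^ 2 := by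
  have hbdd : BddAbove (Set.range fun t : Set.Icc (0:ℝ) 1 =>
      (1 / 2) * ‖fderiv ℝ (gradient c) (x + (t : ℝ) • p)‖) := by
    have hcont : Continuous (fderiv ℝ (gradient c)) :=
      hc.contDiff_one_gradient.continuous_fderiv one_ne_zero
    exact (isCompact_range (by fun_prop)).bddAbove
  intro β hβ
  have h := le_add_inner_gradient_add_of_norm_fderiv_gradient_le hc (M := φ₂)
    (fun t ht => hφ₂ ▸ le_ciSup hbdd ⟨t, ht⟩) hβ
  have hφ₂_nonneg : 0 ≤ φ₂ := hφ₂ ▸ Real.iSup_nonneg fun _ => by positivity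
  have hrem : 0 ≤ φ₂ * β ^ 2 * ‖p‖ ^ 2 := by positivity
  have hlin := mul_le_mul_of_nonneg_left hdesc hβ.1
  have hpos := mul_nonneg (sub_nonneg.2 hβ.2) (le_max_left 0 (c x))
  have hmax := mul_le_mul_of_nonneg_left (le_max_right 0 (c x)) (sub_nonneg.2 hβ.2)
  have : max 0 (c (x + β • p)) ≤ (1 - β) * max 0 (c x) + φ₂ * β ^ 2 * ‖p‖ ^ 2 :=
    max_le (by linarith) (by linarith)
  linarith
end

section
/- Let x ∈ ℝⁿ, p ≠ 0, and let (p, λ) with λ > 0 satisfy the sub-problem KKT system at x: ∇Ψ(x + p) + λ(∇c(x) + J(x)ᵀJ(x)p) = 0 and c(x) + ⟨∇c(x), p⟩ + ½⟨p, J(x)ᵀJ(x)p⟩ = 0. Let r > λ, η ∈ (0,1), and set φ₁ = sup_{t ∈ [0,1]} ½‖∇²Ψ(x + t p)‖ and φ₂ = sup_{t ∈ [0,1]} ½‖∇²c(x + t p)‖. Then for every β ∈ (0,1] with β ≤ (1 − η) λ ⟨p, J(x)ᵀJ(x)p⟩ / (2(φ₁ + r φ₂)‖p‖²), the exact merit function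 F_r(x) = Ψ(x) + r[c(x)]₊ satisfies F_r(x + β p) − F_r(x) ≤ −(η λ β / 2) ⟨p, J(x)ᵀJ(x)p⟩. -/
open RealInnerProductSpace

variable {n m : ℕ}

local notation "En" => EuclideanSpace ℝ (Fin n)
local notation "Em" => EuclideanSpace ℝ (Fin m)

section Descent

variable {E : Type*} [NormedAddCommGroup E] [InnerProductSpace ℝ E] [CompleteSpace E]

theorem ContDiff.gradient_of_two {f : E → ℝ} (hf : ContDiff ℝ 2 f) :
    ContDiff ℝ 1 (gradient f) :=
  (InnerProductSpace.toDual ℝ E).symm.contDiff.comp (hf.fderiv_right (by norm_num))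

theorem hasDerivAt_comp_add_smul {f : E → ℝ} (hf : Differentiable ℝ f) (x p : E) (t : ℝ) :
    HasDerivAt (fun t : ℝ => f (x + t • p)) ⟪gradient f (x + t • p), p⟫ t := by
  have h1 : HasDerivAt (fun t : ℝ => x + t • p) p t := by
    simpa using ((hasDerivAt_id t).smul_const p).const_add x
  have h2 := (hf (x + t • p)).hasGradientAt.hasFDerivAt.comp_hasDerivAt t h1
  exact h2.congr_deriv (by simp)

/-- The gradient of a convex function is monotone. -/
theorem ConvexOn.inner_gradient_le {f : E → ℝ} (hf : Differentiable ℝ f)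
    (hconv : ConvexOn ℝ Set.univ f) (x p : E) :
    ⟪gradient f x, p⟫ ≤ ⟪gradient f (x + p), p⟫ := by
  have hg : ConvexOn ℝ Set.univ (fun t : ℝ => f (x + t • p)) := by
    have := hconv.comp_affineMap (AffineMap.lineMap x (x + p) : ℝ →ᵃ[ℝ] E)
    refine (this.congr fun t _ => ?_)
    simp [AffineMap.lineMap_apply, add_comm]
  have h0 := hasDerivAt_comp_add_smul hf x p 0
  have h1 := hasDerivAt_comp_add_smul hf x p 1
  have h := (hg.le_slope_of_hasDerivAt (Set.mem_univ _) (Set.mem_univ _) one_pos h0).trans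
    (hg.slope_le_of_hasDerivAt (Set.mem_univ _) (Set.mem_univ _) one_pos h1)
  simpa using h

/-- Second-order upper bound along a segment on which the derivative of the gradient is bounded. -/
theorem le_add_inner_gradient_of_norm_fderiv_gradient_le {f : E → ℝ} (hf : ContDiff ℝ 2 f)
    {x p : E} {K : ℝ}
    (hK : ∀ t ∈ Set.Icc (0 : ℝ) 1, (1 / 2) * ‖fderiv ℝ (gradient f) (x + t • p)‖ ≤ K)
    {β : ℝ} (hβ : β ∈ Set.Icc (0 : ℝ) 1) :
    f (x + β • p) ≤ f x + β * ⟪gradient f x, p⟫ + β ^ 2 * K * ‖p‖ ^ 2 := by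
  have hgrad : ∀ t ∈ Set.Icc (0 : ℝ) 1,
      ‖gradient f (x + t • p) - gradient f x‖ ≤ 2 * K * (t * ‖p‖) := by
    intro t ht
    have h := (convex_segment (𝕜 := ℝ) x (x + p)).norm_image_sub_le_of_norm_fderiv_le
      (𝕜 := ℝ) (f := gradient f) (C := 2 * K) (x := x) (y := x + t • p)
      (fun y _ => (hf.gradient_of_two.differentiable one_ne_zero) y)
      (fun y hy => by
        rw [segment_eq_image'] at hy
        obtain ⟨u, hu, rfl⟩ := hy
        have := hK u hu
        simp only [add_sub_cancel_left]
        linarith)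
      (left_mem_segment ℝ _ _)
      (by rw [segment_eq_image']; exact ⟨t, ht, by simp⟩)
    simpa [norm_smul, abs_of_nonneg ht.1] using h
  have hderiv : ∀ t : ℝ, HasDerivAt
      (fun t : ℝ => f (x + t • p) - t * ⟪gradient f x, p⟫ - t ^ 2 * (K * ‖p‖ ^ 2))
      (⟪gradient f (x + t • p), p⟫ - ⟪gradient f x, p⟫ - 2 * t * (K * ‖p‖ ^ 2)) t := by
    intro t
    have h1 := hasDerivAt_comp_add_smul (hf.differentiable two_ne_zero) x p t
    have h2 := (hasDerivAt_id t).mul_const ⟪gradient f x, p⟫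
    have h3 := (hasDerivAt_pow 2 t).mul_const (K * ‖p‖ ^ 2)
    exact ((h1.sub h2).sub h3).congr_deriv (by simp)
  have hanti : AntitoneOn
      (fun t : ℝ => f (x + t • p) - t * ⟪gradient f x, p⟫ - t ^ 2 * (K * ‖p‖ ^ 2))
      (Set.Icc 0 1) := by
    refine antitoneOn_of_deriv_nonpos (convex_Icc 0 1)
      (fun t _ => (hderiv t).continuousAt.continuousWithinAt)
      (fun t _ => (hderiv t).differentiableAt.differentiableWithinAt) fun t ht => ?_
    rw [(hderiv t).deriv, ← inner_sub_left]
    have h1 := real_inner_le_norm (gradient f (x + t • p) - gradient f x) p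
    have h2 := mul_le_mul_of_nonneg_right (hgrad t (interior_subset ht)) (norm_nonneg p)
    nlinarith
  have h := hanti (Set.left_mem_Icc.2 zero_le_one) hβ hβ.1
  simp only [zero_smul, add_zero] at h
  linarith

theorem ContDiff.half_norm_fderiv_gradient_le_iSup {f : E → ℝ} (hf : ContDiff ℝ 2 f) (x p : E)
    {t : ℝ} (ht : t ∈ Set.Icc (0 : ℝ) 1) :
    (1 / 2) * ‖fderiv ℝ (gradient f) (x + t • p)‖ ≤
      ⨆ u : Set.Icc (0 : ℝ) 1, (1 / 2) * ‖fderiv ℝ (gradient f) (x + (u : ℝ) • p)‖ := by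
  have hcont := hf.gradient_of_two.continuous_fderiv one_ne_zero
  have hbdd : BddAbove (Set.range fun u : Set.Icc (0 : ℝ) 1 =>
      (1 / 2) * ‖fderiv ℝ (gradient f) (x + (u : ℝ) • p)‖) :=
    (isCompact_range (by fun_prop)).bddAbove
  exact le_ciSup hbdd ⟨t, ht⟩

end Descent

/-- Scalar estimate behind the descent of the exact merit function. -/
theorem exact_penalty_descent {ψ ψ' c c' Q A B lam r β η : ℝ} (hlam : 0 < lam) (hr : lam < r)
    (hβ0 : 0 ≤ β) (hβ1 : β ≤ 1) (hQ : 0 ≤ Q) (hB : 0 ≤ B)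
    (hψ : ψ' ≤ ψ + β * (lam * (c - Q / 2)) + A)
    (hc : c' ≤ c + β * (-c - Q / 2) + B)
    (hAB : A + r * B ≤ (1 - η) * lam * β * Q / 2) :
    (ψ' + r * max 0 c') - (ψ + r * max 0 c) ≤ -(η * lam * β / 2) * Q := by
  have hr0 : 0 < r := hlam.trans hr
  have hrB : 0 ≤ r * B := mul_nonneg hr0.le hB
  have hβQ : 0 ≤ r * (β * Q) := by positivity
  rcases le_total c' 0 with h' | h' <;> rcases le_total c 0 with h | h
  · rw [max_eq_left h', max_eq_left h]
    have := mul_nonneg (mul_nonneg hβ0 hlam.le) (neg_nonneg.2 h)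
    nlinarith
  · rw [max_eq_left h', max_eq_right h]
    have h1 : β * lam ≤ r := by nlinarith
    have := mul_le_mul_of_nonneg_right h1 h
    nlinarith
  · rw [max_eq_right h', max_eq_left h]
    have h1 := mul_nonneg (mul_nonneg hβ0 hlam.le) (neg_nonneg.2 h)
    have h2 := mul_nonneg (mul_nonneg hr0.le (sub_nonneg.2 hβ1)) (neg_nonneg.2 h)
    have h3 := mul_le_mul_of_nonneg_left hc hr0.le
    nlinarith
  · rw [max_eq_right h', max_eq_right h]
    have h1 := mul_nonneg (mul_nonneg hβ0 (sub_nonneg.2 hr.le)) h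
    have h3 := mul_le_mul_of_nonneg_left hc hr0.le
    nlinarith

/-- Descent of the exact merit function F_r(x) = Ψ(x) + r[c(x)]₊ along
the sub-problem KKT direction, for all sufficiently small step-lengths β. -/
theorem stmt_8
    (s : En → Em) (J : En → (En →L[ℝ] Em)) (b : Em) (σ : ℝ) (hσ : 0 < σ)
    (hs : ContDiff ℝ 2 s) (hJ : ∀ x, HasFDerivAt s (J x) x)
    (Ψ : En → ℝ) (hΨ : ContDiff ℝ 2 Ψ) (hconv : ConvexOn ℝ Set.univ Ψ)
    (c : En → ℝ) (hc : ∀ x, c x = ‖s x - b‖ ^ 2 / 2 - σ ^ 2 / 2)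
    (gradc : En → En)
    (hgradc : ∀ x, gradc x = (ContinuousLinearMap.adjoint (J x)) (s x - b))
    (x p : En) (hp : p ≠ 0) (lam : ℝ) (hlam : 0 < lam)
    (hkkt1 : gradient Ψ (x + p) +
      lam • (gradc x + (ContinuousLinearMap.adjoint (J x)) (J x p)) = 0)
    (hkkt2 : c x + ⟪gradc x, p⟫ +
      (1 / 2) * ⟪p, (ContinuousLinearMap.adjoint (J x)) (J x p)⟫ = 0)
    (r : ℝ) (hr : lam < r) (η : ℝ) (hη : η ∈ Set.Ioo (0:ℝ) 1)
    (φ₁ φ₂ : ℝ)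
    (hφ₁ : φ₁ = ⨆ t : Set.Icc (0:ℝ) 1,
      (1 / 2) * ‖fderiv ℝ (gradient Ψ) (x + (t : ℝ) • p)‖)
    (hφ₂ : φ₂ = ⨆ t : Set.Icc (0:ℝ) 1,
      (1 / 2) * ‖fderiv ℝ (gradient c) (x + (t : ℝ) • p)‖) :
    ∀ β ∈ Set.Ioc (0:ℝ) 1,
      β ≤ (1 - η) * lam * ⟪p, (ContinuousLinearMap.adjoint (J x)) (J x p)⟫ /
          (2 * (φ₁ + r * φ₂) * ‖p‖ ^ 2) →
      (Ψ (x + β • p) + r * max 0 (c (x + β • p))) - (Ψ x + r * max 0 (c x)) ≤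
        -(η * lam * β / 2) * ⟪p, (ContinuousLinearMap.adjoint (J x)) (J x p)⟫ := by
  rintro β ⟨hβ0, hβ1⟩ hβ
  have hc2 : ContDiff ℝ 2 c := by
    rw [funext hc]
    exact (((hs.sub contDiff_const).norm_sq ℝ).div_const 2).sub contDiff_const
  have hgrad : gradient c x = gradc x := by
    have h1 : HasFDerivAt c (InnerProductSpace.toDual ℝ En (gradc x)) x := by
      have h := (((hJ x).sub_const b).norm_sq.mul_const (1 / 2)).sub_const (σ ^ 2 / 2)
      refine (h.congr_fderiv ?_).congr_of_eventuallyEq (.of_forall fun y => ?_)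
      · ext y
        simp [hgradc, ContinuousLinearMap.adjoint_inner_left]
      · rw [hc]
        ring
    exact HasGradientAt.gradient (hasGradientAt_iff_hasFDerivAt.2 h1)
  have hβI : β ∈ Set.Icc (0 : ℝ) 1 := ⟨hβ0.le, hβ1⟩
  have hΨb := le_add_inner_gradient_of_norm_fderiv_gradient_le (K := φ₁) hΨ
    (fun t ht => hφ₁ ▸ hΨ.half_norm_fderiv_gradient_le_iSup x p ht) hβI
  have hcb := le_add_inner_gradient_of_norm_fderiv_gradient_le (K := φ₂) hc2
    (fun t ht => hφ₂ ▸ hc2.half_norm_fderiv_gradient_le_iSup x p ht) hβI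
  have hφ₁0 : 0 ≤ φ₁ := hφ₁ ▸ Real.iSup_nonneg fun _ => by positivity
  have hφ₂0 : 0 ≤ φ₂ := hφ₂ ▸ Real.iSup_nonneg fun _ => by positivity
  have hmono := hconv.inner_gradient_le (hΨ.differentiable two_ne_zero) x p
  have hkkt := congrArg (fun v => ⟪v, p⟫) hkkt1
  simp only [inner_add_left, inner_smul_left, inner_zero_left, conj_trivial] at hkkt
  rw [real_inner_comm p (ContinuousLinearMap.adjoint (J x) (J x p))] at hkkt
  rw [hgrad] at hcb
  have hQ : 0 ≤ ⟪p, (ContinuousLinearMap.adjoint (J x)) (J x p)⟫ := by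
    rw [ContinuousLinearMap.adjoint_inner_right]
    exact real_inner_self_nonneg
  set Q := ⟪p, (ContinuousLinearMap.adjoint (J x)) (J x p)⟫
  have hr0 : 0 < r := hlam.trans hr
  have hD0 : 0 ≤ 2 * (φ₁ + r * φ₂) * ‖p‖ ^ 2 := by positivity
  have hD : 0 < 2 * (φ₁ + r * φ₂) * ‖p‖ ^ 2 := by
    refine hD0.lt_of_ne fun h => ?_
    rw [← h, div_zero] at hβ
    exact absurd hβ0 hβ.not_gt
  rw [le_div_iff₀ hD] at hβ
  have hstep := mul_le_mul_of_nonneg_left hβ hβ0.le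
  have hslope : ⟪gradient Ψ x, p⟫ ≤ lam * (c x - Q / 2) := by
    have h : ⟪gradc x, p⟫ = -c x - Q / 2 := by linarith
    rw [h] at hkkt
    linarith
  have hslopeβ := mul_le_mul_of_nonneg_left hslope hβ0.le
  refine exact_penalty_descent (A := β ^ 2 * φ₁ * ‖p‖ ^ 2) (B := β ^ 2 * φ₂ * ‖p‖ ^ 2)
    hlam hr hβ0.le hβ1 hQ (by positivity) (by linarith) ?_ (by linarith)
  have h : ⟪gradc x, p⟫ = -c x - Q / 2 := by linarith
  rwa [h] at hcb
end

section
/- Let η ∈ (0,1), r₀ > 0, μ > 0 and γ > 0. Suppose (x_k)_{k≥0} ⊂ ℝⁿ, (p_k)_{k≥1} ⊂ ℝⁿ, (λ_k)_{k≥1} ⊂ ℝ, (β_k)_{k≥1} ⊂ (0,1] and (r_k)_{k≥1} ⊂ ℝ are sequences such that for every k ≥ 1: (i) x_k = x_{k−1} + β_k p_k; (ii) (p_k, λ_k) satisfies the sub-problem KKT system at x_{k−1}, i.e. ∇Ψ(x_{k−1} + p_k) + λ_k(∇c(x_{k−1}) + J(x_{k−1})ᵀJ(x_{k−1})p_k)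 = 0 and c(x_{k−1}) + ⟨∇c(x_{k−1}), p_k⟩ + ½⟨p_k, J(x_{k−1})ᵀJ(x_{k−1})p_k⟩ = 0; (iii) r_k = max(2λ_k, r_{k−1}); (iv) the descent condition F_{r_k}(x_k) − F_{r_k}(x_{k−1}) ≤ −(η λ_k β_k / 2)⟨p_k, J(x_{k−1})ᵀJ(x_{k−1})p_k⟩ holds, where F_r(x) = Ψ(x) + r[c(x)]₊; (v) ⟨v, J(x_{k−1})ᵀJ(x_{k−1})v⟩ ≥ μ‖v‖² for all v ∈ ℝⁿ; (vi) β_k λ_k > γ. Assume moreover that the sequence (x_k, λ_k) is bounded. Then there exists a subsequence of (x_k, λ_k) converging to a pair (x̄, λ̄) satisfying ∇Ψ(x̄) + λ̄ ∇c(x̄) = 0 and c(x̄) = 0. -/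
open RealInnerProductSpace

variable {n m : ℕ}

local notation "En" => EuclideanSpace ℝ (Fin n)
local notation "Em" => EuclideanSpace ℝ (Fin m)

open Filter Topology

/-- If each step decreases a sequence bounded below by at least a fixed multiple of `‖p k‖ ^ 2`,
then `p` tends to zero. -/
theorem tendsto_zero_of_sq_norm_le_sub {E : Type*} [NormedAddCommGroup E] {G : ℕ → ℝ} {p : ℕ → E}
    {δ B : ℝ} (hδ : 0 < δ) (hB : ∀ k, B ≤ G k) (h : ∀ k, δ * ‖p k‖ ^ 2 ≤ G k - G (k + 1)) :
    Tendsto p atTop (𝓝 0) := by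
  have hanti : Antitone G := antitone_nat_of_succ_le fun k => by
    have := h k
    have : 0 ≤ δ * ‖p k‖ ^ 2 := by positivity
    linarith
  have hG : Tendsto G atTop (𝓝 (⨅ k, G k)) :=
    tendsto_atTop_ciInf hanti ⟨B, by rintro _ ⟨k, rfl⟩; exact hB k⟩
  have hdiff : Tendsto (fun k => (G k - G (k + 1)) / δ) atTop (𝓝 0) := by
    simpa using (hG.sub (hG.comp (tendsto_add_atTop_nat 1))).div_const δ
  have hsq : Tendsto (fun k => ‖p k‖ ^ 2) atTop (𝓝 0) :=
    squeeze_zero (fun k => by positivity)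
      (fun k => by rw [le_div_iff₀ hδ]; linarith [h k]) hdiff
  rw [tendsto_zero_iff_norm_tendsto_zero]
  simpa [Real.sqrt_sq] using hsq.sqrt

/-- The merit values `f (x k) + r k * g (x k)`, with nondecreasing bounded penalty parameters,
force the steps to vanish under sufficient decrease. -/
theorem tendsto_zero_of_penalty_descent {E X : Type*} [NormedAddCommGroup E] {f g : X → ℝ}
    {x : ℕ → X} {r : ℕ → ℝ} {p : ℕ → E} {δ B C R : ℝ} (hδ : 0 < δ) (hC₀ : 0 ≤ C)
    (hf : ∀ k, B ≤ f (x k)) (hg₀ : ∀ y, 0 ≤ g y) (hg : ∀ k, g (x k) ≤ C)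
    (hr₀ : 0 ≤ r 0) (hr : Monotone r) (hR : ∀ k, r k ≤ R)
    (h : ∀ k, f (x (k + 1)) + r (k + 1) * g (x (k + 1)) - (f (x k) + r (k + 1) * g (x k)) ≤
      -(δ * ‖p k‖ ^ 2)) :
    Tendsto p atTop (𝓝 0) := by
  refine tendsto_zero_of_sq_norm_le_sub (G := fun k => f (x k) + r k * g (x k) - C * r k)
    (B := B - C * R) hδ (fun k => ?_) (fun k => ?_)
  · have h₁ := mul_nonneg (hr₀.trans (hr (Nat.zero_le k))) (hg₀ (x k))
    have h₂ := mul_le_mul_of_nonneg_left (hR k) hC₀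
    have := hf k
    linarith
  · have h₁ := mul_nonneg (sub_nonneg.2 (hr (Nat.le_succ k))) (sub_nonneg.2 (hg k))
    have := h k
    simp only [Nat.succ_eq_add_one] at h₁
    nlinarith

theorem continuous_gradient_of_contDiff {E : Type*} [NormedAddCommGroup E] [InnerProductSpace ℝ E]
    [CompleteSpace E] {f : E → ℝ} (hf : ContDiff ℝ 1 f) : Continuous (gradient f) :=
  (InnerProductSpace.toDual ℝ E).symm.continuous.comp (hf.continuous_fderiv one_ne_zero)

/-- Subsequence convergence of the sequential method to a KKT point of
the equality constrained problem. -/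
theorem stmt_9
    (s : En → Em) (J : En → (En →L[ℝ] Em)) (b : Em) (σ : ℝ) (hσ : 0 < σ)
    (hs : ContDiff ℝ 1 s) (hJ : ∀ x, HasFDerivAt s (J x) x)
    (Ψ : En → ℝ) (hΨ : ContDiff ℝ 2 Ψ) (hconv : ConvexOn ℝ Set.univ Ψ)
    (c : En → ℝ) (hc : ∀ x, c x = ‖s x - b‖ ^ 2 / 2 - σ ^ 2 / 2)
    (gradc : En → En)
    (hgradc : ∀ x, gradc x = (ContinuousLinearMap.adjoint (J x)) (s x - b))
    (η r₀ μ γ : ℝ) (hη : η ∈ Set.Ioo (0:ℝ) 1) (hr₀ : 0 < r₀) (hμ : 0 < μ) (hγ : 0 < γ)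
    (x : ℕ → En) (p : ℕ → En) (lam : ℕ → ℝ) (β : ℕ → ℝ) (r : ℕ → ℝ)
    (hr0 : r 0 = r₀)
    (hβ : ∀ k, 1 ≤ k → β k ∈ Set.Ioc (0:ℝ) 1)
    (hx : ∀ k, 1 ≤ k → x k = x (k - 1) + β k • p k)
    (hkkt1 : ∀ k, 1 ≤ k → gradient Ψ (x (k - 1) + p k) +
      lam k • (gradc (x (k - 1)) +
        (ContinuousLinearMap.adjoint (J (x (k - 1)))) (J (x (k - 1)) (p k))) = 0)
    (hkkt2 : ∀ k, 1 ≤ k → c (x (k - 1)) + ⟪gradc (x (k - 1)), p k⟫ +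
      (1 / 2) * ⟪p k,
        (ContinuousLinearMap.adjoint (J (x (k - 1)))) (J (x (k - 1)) (p k))⟫ = 0)
    (hrk : ∀ k, 1 ≤ k → r k = max (2 * lam k) (r (k - 1)))
    (hdesc : ∀ k, 1 ≤ k →
      (Ψ (x k) + r k * max 0 (c (x k))) -
          (Ψ (x (k - 1)) + r k * max 0 (c (x (k - 1)))) ≤
        -(η * lam k * β k / 2) * ⟪p k,
          (ContinuousLinearMap.adjoint (J (x (k - 1)))) (J (x (k - 1)) (p k))⟫)
    (hpd : ∀ k, 1 ≤ k → ∀ v : En,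
      μ * ‖v‖ ^ 2 ≤ ⟪v, (ContinuousLinearMap.adjoint (J (x (k - 1)))) (J (x (k - 1)) v)⟫)
    (hβlam : ∀ k, 1 ≤ k → γ < β k * lam k)
    (hbdd : ∃ M : ℝ, ∀ k, ‖x k‖ ≤ M ∧ |lam k| ≤ M) :
    ∃ (φ : ℕ → ℕ) (xbar : En) (lambar : ℝ), StrictMono φ ∧
      Filter.Tendsto (fun j => (x (φ j), lam (φ j))) Filter.atTop (nhds (xbar, lambar)) ∧
      gradient Ψ xbar + lambar • gradc xbar = 0 ∧ c xbar = 0 := by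
  obtain ⟨M, hM⟩ := hbdd
  have hJc : Continuous J := by
    rw [show J = fderiv ℝ s from funext fun y => (hJ y).fderiv.symm]
    exact hs.continuous_fderiv one_ne_zero
  have hsc : Continuous s := hs.continuous
  have hadj : Continuous fun y => ContinuousLinearMap.adjoint (J y) :=
    ContinuousLinearMap.adjoint.continuous.comp hJc
  have hgc : Continuous gradc := by
    rw [funext hgradc]
    exact hadj.clm_apply (hsc.sub continuous_const)
  have hcc : Continuous c := by
    rw [funext hc]
    fun_prop
  have hΨg : Continuous (gradient Ψ) :=
    continuous_gradient_of_contDiff (hΨ.of_le (by norm_num))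
  have hxmem : ∀ k, x k ∈ Metric.closedBall (0 : En) M := fun k => by simpa using (hM k).1
  have hcpt : IsCompact (Metric.closedBall (0 : En) M) := isCompact_closedBall _ _
  obtain ⟨B, hB⟩ := hcpt.bddBelow_image hΨ.continuous.continuousOn
  obtain ⟨C, hC⟩ := hcpt.bddAbove_image (f := fun y => max 0 (c y))
    (continuous_const.max hcc).continuousOn
  have hCx : ∀ k, max 0 (c (x k)) ≤ C := fun k => hC ⟨_, hxmem k, rfl⟩
  have hrmono : Monotone r := monotone_nat_of_le_succ fun k => by
    rw [hrk (k + 1) (Nat.le_add_left 1 k)]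
    exact le_max_right _ _
  have hrR : ∀ k, r k ≤ max (2 * M) r₀ := fun k => by
    induction k with
    | zero => exact hr0 ▸ le_max_right _ _
    | succ k ih =>
      rw [hrk (k + 1) (Nat.le_add_left 1 k)]
      refine max_le (le_max_of_le_left ?_) ih
      linarith [le_abs_self (lam (k + 1)), (hM (k + 1)).2]
  have hp : Tendsto (fun k => p (k + 1)) atTop (𝓝 0) := by
    refine tendsto_zero_of_penalty_descent (f := Ψ) (g := fun y => max 0 (c y)) (x := x) (r := r)
      (δ := η * γ / 2 * μ) (B := B) (C := C) (R := max (2 * M) r₀)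
      (by have := hη.1; positivity) ((le_max_left _ _).trans (hCx 0))
      (fun k => hB ⟨_, hxmem k, rfl⟩) (fun y => le_max_left _ _) hCx
      (hr0 ▸ hr₀.le) hrmono hrR (fun k => ?_)
    have hk : 1 ≤ k + 1 := Nat.le_add_left 1 k
    refine (hdesc (k + 1) hk).trans ?_
    have hcoef : η * γ / 2 ≤ η * lam (k + 1) * β (k + 1) / 2 := by
      nlinarith [hβlam (k + 1) hk, hη.1]
    have hγ₀ : 0 ≤ η * γ / 2 := by have := hη.1; positivity
    have := mul_le_mul hcoef (hpd (k + 1) hk (p (k + 1))) (by positivity) (hγ₀.trans hcoef)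
    linarith
  have hstep : Tendsto (fun k => β (k + 1) • p (k + 1)) atTop (𝓝 0) := by
    refine squeeze_zero_norm (fun k => ?_) (tendsto_zero_iff_norm_tendsto_zero.1 hp)
    have := hβ (k + 1) (Nat.le_add_left 1 k)
    rw [norm_smul, Real.norm_of_nonneg this.1.le]
    exact mul_le_of_le_one_left (norm_nonneg _) this.2
  obtain ⟨⟨xbar, lambar⟩, -, ψ, hψ, hlim⟩ :=
    (hcpt.prod (isCompact_Icc (a := -M) (b := M))).tendsto_subseq
      (x := fun k => (x (k + 1), lam (k + 1)))
      (fun k => ⟨hxmem _, abs_le.1 (hM _).2⟩)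
  have hpψ := hp.comp hψ.tendsto_atTop
  have hlamψ : Tendsto (fun j => lam (ψ j + 1)) atTop (𝓝 lambar) :=
    (continuous_snd.tendsto _).comp hlim
  have hxψ : Tendsto (fun j => x (ψ j)) atTop (𝓝 xbar) := by
    have h := ((continuous_fst.tendsto _).comp hlim).sub (hstep.comp hψ.tendsto_atTop)
    rw [sub_zero] at h
    refine h.congr fun j => ?_
    simp [hx (ψ j + 1) (Nat.le_add_left 1 _)]
  have hJp : Tendsto (fun j => ContinuousLinearMap.adjoint (J (x (ψ j))) (J (x (ψ j)) (p (ψ j + 1))))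
      atTop (𝓝 0) := by
    have hcont : Continuous fun q : En × En => ContinuousLinearMap.adjoint (J q.1) (J q.1 q.2) :=
      (hadj.comp continuous_fst).clm_apply ((hJc.comp continuous_fst).clm_apply continuous_snd)
    simpa [Function.comp_def] using (hcont.tendsto (xbar, 0)).comp (hxψ.prodMk_nhds hpψ)
  have hgψ := (hgc.tendsto xbar).comp hxψ
  refine ⟨fun j => ψ j + 1, xbar, lambar, fun i j hij => Nat.succ_lt_succ (hψ hij), hlim, ?_, ?_⟩
  · have h := ((hΨg.tendsto _).comp (hxψ.add hpψ)).add (hlamψ.smul (hgψ.add hJp))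
    rw [add_zero, add_zero] at h
    exact tendsto_nhds_unique h (tendsto_const_nhds.congr fun j =>
      (hkkt1 (ψ j + 1) (Nat.le_add_left 1 _)).symm)
  · have h := (((hcc.tendsto _).comp hxψ).add (hgψ.inner (𝕜 := ℝ) hpψ)).add
      ((hpψ.inner (𝕜 := ℝ) hJp).const_mul (1 / 2))
    rw [inner_zero_right, inner_zero_right, mul_zero, add_zero, add_zero] at h
    exact tendsto_nhds_unique h (tendsto_const_nhds.congr fun j =>
      (hkkt2 (ψ j + 1) (Nat.le_add_left 1 _)).symm)
end

section
/- Under the assumptions of the convergence theorem for the sequential method — namely sequences with x_k = x_{k−1} + β_k p_k, (p_k, λ_k) solving the sub-problem KKT system at x_{k−1}, penalty parameters r_k = max(2λ_k, r_{k−1}) that are eventually constant equal to r, the descent condition F_r(x_k) − F_r(x_{k−1}) ≤ −(η λ_k β_k / 2)⟨p_k, J(x_{k−1})ᵀJ(x_{k−1})p_k⟩ for all large k, uniform positive definiteness ⟨v, J(x_{k−1})ᵀJ(x_{k−1})v⟩ ≥ μ‖v‖² with μ > 0, step–multiplier lower bound β_k λ_k > γ > 0, and the sequence (F_r(x_k))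 bounded below — the search directions satisfy p_k → 0 as k → ∞. -/
open RealInnerProductSpace

variable {n m : ℕ}

local notation "En" => EuclideanSpace ℝ (Fin n)
local notation "Em" => EuclideanSpace ℝ (Fin m)

/-- If a sequence `F` bounded below eventually decreases at each step by at least a fixed positive
multiple of `‖p (k + 1)‖ ^ 2`, then `p` tends to zero. -/
theorem tendsto_zero_of_sufficient_decrease {E : Type*} [NormedAddCommGroup E] {F : ℕ → ℝ}
    {p : ℕ → E} {a C : ℝ} (ha : 0 < a) (hC : ∀ k, C ≤ F k) {N : ℕ}
    (hdec : ∀ k, N ≤ k → a * ‖p (k + 1)‖ ^ 2 ≤ F k - F (k + 1)) :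
    Filter.Tendsto p Filter.atTop (nhds 0) := by
  have hanti : Antitone fun k => F (k + N) := by
    refine antitone_nat_of_succ_le fun k => ?_
    have h := hdec (k + N) (by omega)
    rw [show k + 1 + N = k + N + 1 by omega]
    nlinarith [mul_nonneg ha.le (sq_nonneg ‖p (k + N + 1)‖)]
  have hbdd : BddBelow (Set.range fun k => F (k + N)) :=
    ⟨C, by rintro _ ⟨k, rfl⟩; exact hC _⟩
  have hF := (Filter.tendsto_add_atTop_iff_nat N).1 (tendsto_atTop_ciInf hanti hbdd)
  have hdiff : Filter.Tendsto (fun k => (F k - F (k + 1)) / a) Filter.atTop (nhds 0) := by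
    simpa using (hF.sub ((Filter.tendsto_add_atTop_iff_nat 1).2 hF)).div_const a
  have hsq : Filter.Tendsto (fun k => ‖p (k + 1)‖ ^ 2) Filter.atTop (nhds 0) := by
    refine squeeze_zero' (.of_forall fun k => sq_nonneg _) ?_ hdiff
    filter_upwards [Filter.eventually_ge_atTop N] with k hk
    rw [le_div_iff₀ ha, mul_comm]
    exact hdec k hk
  rw [← Filter.tendsto_add_atTop_iff_nat 1, tendsto_zero_iff_norm_tendsto_zero]
  simpa using hsq.sqrt

/-- Under the assumptions of the convergence theorem, with eventually
constant penalty parameter r and F_r(x_k) bounded below, the directions p_k → 0. -/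
theorem stmt_10
    (s : En → Em) (J : En → (En →L[ℝ] Em)) (b : Em) (σ : ℝ) (hσ : 0 < σ)
    (hs : ContDiff ℝ 1 s) (hJ : ∀ x, HasFDerivAt s (J x) x)
    (Ψ : En → ℝ) (hΨ : ContDiff ℝ 2 Ψ) (hconv : ConvexOn ℝ Set.univ Ψ)
    (c : En → ℝ) (hc : ∀ x, c x = ‖s x - b‖ ^ 2 / 2 - σ ^ 2 / 2)
    (gradc : En → En)
    (hgradc : ∀ x, gradc x = (ContinuousLinearMap.adjoint (J x)) (s x - b))
    (η μ γ r : ℝ) (hη : η ∈ Set.Ioo (0:ℝ) 1) (hμ : 0 < μ) (hγ : 0 < γ)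
    (x : ℕ → En) (p : ℕ → En) (lam : ℕ → ℝ) (β : ℕ → ℝ) (rs : ℕ → ℝ)
    (hβ : ∀ k, 1 ≤ k → β k ∈ Set.Ioc (0:ℝ) 1)
    (hx : ∀ k, 1 ≤ k → x k = x (k - 1) + β k • p k)
    (hkkt1 : ∀ k, 1 ≤ k → gradient Ψ (x (k - 1) + p k) +
      lam k • (gradc (x (k - 1)) +
        (ContinuousLinearMap.adjoint (J (x (k - 1)))) (J (x (k - 1)) (p k))) = 0)
    (hkkt2 : ∀ k, 1 ≤ k → c (x (k - 1)) + ⟪gradc (x (k - 1)), p k⟫ +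
      (1 / 2) * ⟪p k,
        (ContinuousLinearMap.adjoint (J (x (k - 1)))) (J (x (k - 1)) (p k))⟫ = 0)
    (hrk : ∀ k, 1 ≤ k → rs k = max (2 * lam k) (rs (k - 1)))
    (hrconst : ∃ N : ℕ, ∀ k, N ≤ k → rs k = r)
    (hdesc : ∃ N : ℕ, ∀ k, N ≤ k → 1 ≤ k →
      (Ψ (x k) + r * max 0 (c (x k))) -
          (Ψ (x (k - 1)) + r * max 0 (c (x (k - 1)))) ≤
        -(η * lam k * β k / 2) * ⟪p k,
          (ContinuousLinearMap.adjoint (J (x (k - 1)))) (J (x (k - 1)) (p k))⟫)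
    (hpd : ∀ k, 1 ≤ k → ∀ v : En,
      μ * ‖v‖ ^ 2 ≤ ⟪v, (ContinuousLinearMap.adjoint (J (x (k - 1)))) (J (x (k - 1)) v)⟫)
    (hβlam : ∀ k, 1 ≤ k → γ < β k * lam k)
    (hbelow : ∃ C : ℝ, ∀ k, C ≤ Ψ (x k) + r * max 0 (c (x k))) :
    Filter.Tendsto p Filter.atTop (nhds 0) := by
  obtain ⟨N, hN⟩ := hdesc
  obtain ⟨C, hC⟩ := hbelow
  have ha : 0 < η * γ * μ / 2 := by have := hη.1; positivity
  refine tendsto_zero_of_sufficient_decrease (N := N)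
    (F := fun k => Ψ (x k) + r * max 0 (c (x k))) ha hC fun k hk => ?_
  have hstep := hN (k + 1) (by omega) (by omega)
  have hcurv := hpd (k + 1) (by omega) (p (k + 1))
  have hmul : γ * (μ * ‖p (k + 1)‖ ^ 2) ≤ β (k + 1) * lam (k + 1) * _ :=
    mul_le_mul (hβlam (k + 1) (by omega)).le hcurv (by positivity)
      (hγ.trans (hβlam (k + 1) (by omega))).le
  have hη_mul := mul_le_mul_of_nonneg_left hmul hη.1.le
  simp only [Nat.add_sub_cancel] at hstep hη_mul ⊢
  linarith
end
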